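/- For every ε with 0 < ε < 1, there exists a chore instance such that for every allocation (A_1,…,A_n) there is an agent i with v_i(A_i) ≥ (2−ε)·WMMS_i; consequently, no algorithm can guarantee better than 2-approximate WMMS allocations for chores. -/

import Mathlib

open Finset

namespace Chores

/-- The cost incurred by agent `j` under the assignment `f` of items to agents
(item `e` is given to agent `f e`); ordered partitions of the item set into `n`
(possibly empty) bundles correspond exactly to such assignments. -/
noncomputable def cost {ι : Type*} [Fintype ι] {n : ℕ} (v : ι → ℝ) (f : ι → Fin n)
    (j : Fin n) : ℝ :=
  ∑ e ∈ univ.filter (fun e => f e = j), v e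

/-- The weighted maximin share of agent `i`, where `w` is the weight vector and
`v` is agent `i`'s own (additive) item cost function:
`WMMS_i = w_i * min over allocations (B_1,…,B_n) of max_j v_i(B_j)/w_j`. -/
noncomputable def WMMS {ι : Type*} [Fintype ι] {n : ℕ} (w : Fin n → ℝ) (v : ι → ℝ)
    (i : Fin n) : ℝ :=
  w i * ⨅ f : ι → Fin n, ⨆ j : Fin n, cost v f j / w j

/-- A chore instance: every agent has a positive weight and nonnegative item costs. -/
def ChoreInstance {ι : Type*} {n : ℕ} (w : Fin n → ℝ) (v : Fin n → ι → ℝ) : Prop :=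
  (∀ i, 0 < w i) ∧ ∀ i e, 0 ≤ v i e

/-- If every bundle of some allocation costs at most the weight of its owner, then the weighted
maximin share of each agent is at most its weight. -/
lemma WMMS_le_weight {ι : Type*} [Fintype ι] {n : ℕ} {w : Fin n → ℝ} (hw : ∀ j, 0 < w j)
    {v : ι → ℝ} {f : ι → Fin n} (hf : ∀ j, cost v f j ≤ w j) (i : Fin n) :
    WMMS w v i ≤ w i := by
  classical
  have : Nonempty (Fin n) := ⟨i⟩
  refine mul_le_of_le_one_right (hw i).le ?_
  refine (ciInf_le (Set.finite_range _).bddBelow f).trans (ciSup_le fun j => ?_)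
  exact (div_le_one (hw j)).2 (hf j)

/-- With at least one item and positive costs, weighted maximin shares are positive. -/
lemma WMMS_pos {ι : Type*} [Fintype ι] [Nonempty ι] {n : ℕ} {w : Fin n → ℝ}
    (hw : ∀ j, 0 < w j) {v : ι → ℝ} (hv : ∀ e, 0 < v e) (i : Fin n) : 0 < WMMS w v i := by
  classical
  have : Nonempty (Fin n) := ⟨i⟩
  refine mul_pos (hw i) ?_
  obtain ⟨f, hf⟩ := exists_eq_ciInf_of_finite
    (f := fun f : ι → Fin n => ⨆ j : Fin n, cost v f j / w j)
  rw [← hf]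
  obtain ⟨e⟩ := ‹Nonempty ι›
  have hpos : 0 < cost v f (f e) / w (f e) :=
    div_pos (sum_pos (fun e _ => hv e) ⟨e, by simp⟩) (hw _)
  exact hpos.trans_le
    (le_ciSup (f := fun j => cost v f j / w j) (Set.finite_range _).bddAbove (f e))

/-- There is a finite family labelled by `s` in which every label `l` occurs exactly `N l` times. -/
lemma exists_labelling (s : Finset ℕ) (N : ℕ → ℕ) :
    ∃ (n : ℕ) (lab : Fin n → ℕ), (∀ i, lab i ∈ s) ∧
      ∀ l ∈ s, (univ.filter fun i => lab i = l).card = N l := by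
  let e := Fintype.equivFin (Σ l : s, Fin (N l))
  refine ⟨_, fun i => ((e.symm i).1 : ℕ), fun i => (e.symm i).1.2, fun l hl => ?_⟩
  have : Fintype.card {i // ((e.symm i).1 : ℕ) = l} = Fintype.card (Fin (N l)) := by
    refine Fintype.card_congr ((e.symm.subtypeEquiv (q := fun x => (x.1 : ℕ) = l)
      fun _ => Iff.rfl).trans ?_)
    exact ((Equiv.refl _).subtypeEquiv (q := fun x => x.1 = (⟨l, hl⟩ : s))
      fun x => by simp [Subtype.ext_iff]).trans (Equiv.sigmaSubtype (⟨l, hl⟩ : s))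
  rw [← Fintype.card_subtype, this, Fintype.card_fin]

/-- Summing a function of the label amounts to summing over labels with multiplicity. -/
lemma sum_labels {R : Type*} [Semiring R] {n : ℕ} {s : Finset ℕ} {N : ℕ → ℕ} {lab : Fin n → ℕ}
    (hs : ∀ i, lab i ∈ s) (hN : ∀ l ∈ s, (univ.filter fun i => lab i = l).card = N l)
    (g : ℕ → R) : ∑ i, g (lab i) = ∑ l ∈ s, (N l : R) * g l := by
  rw [← sum_fiberwise_of_maps_to (fun i _ => hs i)]
  refine sum_congr rfl fun l hl => ?_
  rw [sum_congr rfl fun i hi => by rw [(mem_filter.1 hi).2], sum_const, hN l hl, nsmul_eq_mul]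

/-- Items can be distributed among recipients of sufficient total capacity without exceeding any
individual capacity. -/
lemma exists_assignment {ι κ : Type*} [Fintype κ] [DecidableEq κ] [Nonempty κ]
    (S : Finset ι) (k : κ → ℕ) (h : S.card ≤ ∑ j, k j) :
    ∃ f : ι → κ, ∀ j, (S.filter fun e => f e = j).card ≤ k j := by
  classical
  obtain ⟨g⟩ : Nonempty (S ↪ Σ j, Fin (k j)) :=
    Function.Embedding.nonempty_of_card_le (by simpa using h)
  refine ⟨fun e => if he : e ∈ S then (g ⟨e, he⟩).1 else Classical.arbitrary κ, fun j => ?_⟩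
  have hmaps : ∀ e ∈ (S.attach.filter fun e => (g e).1 = j).image g,
      e ∈ univ.image (Sigma.mk (β := fun j => Fin (k j)) j) := by
    intro x hx
    obtain ⟨e, he, rfl⟩ := mem_image.1 hx
    obtain ⟨-, rfl⟩ := mem_filter.1 he
    exact mem_image.2 ⟨(g e).2, mem_univ _, rfl⟩
  calc (S.filter _).card
      ≤ ((S.attach.filter fun e => (g e).1 = j).image Subtype.val).card := by
        refine card_le_card fun e he => ?_
        obtain ⟨heS, hej⟩ := mem_filter.1 he
        simp only [dif_pos heS] at hej
        exact mem_image.2 ⟨⟨e, heS⟩, by simpa using hej, rfl⟩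
    _ = ((S.attach.filter fun e => (g e).1 = j).image g).card := by
        rw [card_image_of_injective _ Subtype.val_injective, card_image_of_injective _ g.injective]
    _ ≤ (univ.image (Sigma.mk (β := fun j => Fin (k j)) j)).card := card_le_card hmaps
    _ ≤ k j := card_image_le.trans (by simp)

/-- The weight of an agent of level `l`. -/
noncomputable def levelWeight (D l : ℕ) : ℝ := if l = 0 then 2 else 1 / (2 * (D : ℝ) ^ l)

/-- The cost of an item of class `c` for an agent of level `l`. -/
noncomputable def levelCost (D l c : ℕ) : ℝ :=
  if c < l then 2 * levelWeight D l
  else if c = l then levelWeight D l else levelWeight D c / 2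

/-- The number of items of class `c` that an agent of level `k` receives in the maximin
allocation of an agent of level `l`. -/
def capacity (D l c k : ℕ) : ℕ :=
  if c < l then (if k = 0 then 2 * (2 * D) ^ c else 0)
  else if c = l then (if k = 0 then 2 * D ^ l else if k ≤ l then D ^ (l - k) else 0)
  else if k = c then 2 else 0

/-- The weight attached to an item of class `c` in the double counting argument. -/
noncomputable def price (D c : ℕ) : ℝ := levelWeight D c / 2 / 2 ^ c

lemma levelWeight_pos {D : ℕ} (hD : 0 < D) (l : ℕ) : 0 < levelWeight D l := by
  unfold levelWeight
  split_ifs <;> positivity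

lemma levelCost_pos {D : ℕ} (hD : 0 < D) (l c : ℕ) : 0 < levelCost D l c := by
  have := levelWeight_pos hD
  unfold levelCost
  split_ifs
  · exact mul_pos two_pos (this l)
  · exact this l
  · exact half_pos (this c)

lemma le_sum_capacity {D L l c : ℕ} (hc : c ∈ Icc 1 L) :
    2 * (2 * D) ^ c ≤ ∑ k ∈ range (L + 1), (2 * D) ^ k * capacity D l c k := by
  rw [mem_Icc] at hc
  rcases lt_trichotomy c l with h | rfl | h
  · calc 2 * (2 * D) ^ c = (2 * D) ^ 0 * capacity D l c 0 := by simp [capacity, h]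
      _ ≤ _ := single_le_sum (f := fun k => (2 * D) ^ k * capacity D l c k)
        (fun _ _ => Nat.zero_le _) (by simp)
  · have hgeom : ∀ t : ℕ, ∑ k ∈ range t, 2 ^ (k + 1) + 2 = 2 ^ (t + 1) := fun t => by
      induction t with
      | zero => simp
      | succ t ih => rw [sum_range_succ, pow_succ 2 (t + 1), ← ih]; ring
    calc 2 * (2 * D) ^ c = ∑ k ∈ range c, 2 ^ (k + 1) * D ^ c + 2 * D ^ c := by
          rw [← sum_mul, ← add_mul, hgeom, mul_pow, pow_succ]; ring
      _ = ∑ k ∈ range (c + 1), (2 * D) ^ k * capacity D c c k := by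
          rw [sum_range_succ']
          congr 1
          · refine sum_congr rfl fun k hk => ?_
            have hk' : k + 1 ≤ c := mem_range.1 hk
            rw [capacity, if_neg (lt_irrefl c), if_pos rfl, if_neg k.succ_ne_zero, if_pos hk',
              mul_pow, mul_assoc, ← pow_add, Nat.add_sub_cancel' hk']
          · simp [capacity]
      _ ≤ _ := sum_le_sum_of_subset (range_mono (by omega))
  · calc 2 * (2 * D) ^ c = (2 * D) ^ c * capacity D l c c := by
          rw [capacity, if_neg (by omega), if_neg (by omega), if_pos rfl]; ring
      _ ≤ _ := single_le_sum (f := fun k => (2 * D) ^ k * capacity D l c k)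
        (fun _ _ => Nat.zero_le _) (by simp; omega)

lemma sum_lower_classes_le {D L l : ℕ} (hD : D = 2 ^ (L + 1)) (hl : l ≤ L) :
    ∑ c ∈ Ico 1 l, (2 * (2 * (D : ℝ)) ^ c) * (2 * levelWeight D l) ≤ 1 := by
  have hD0 : (0 : ℝ) < D := by rw [hD]; positivity
  have hD1 : (1 : ℝ) ≤ D := by rw [hD]; exact_mod_cast Nat.one_le_two_pow
  have hgeom : ∀ t : ℕ, ∑ c ∈ range t, (2 : ℝ) ^ (c + 1) ≤ 2 ^ (t + 1) := fun t => by
    induction t with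
    | zero => simp
    | succ t ih => rw [sum_range_succ, pow_succ 2 (t + 1)]; linarith
  calc ∑ c ∈ Ico 1 l, (2 * (2 * (D : ℝ)) ^ c) * (2 * levelWeight D l)
      ≤ ∑ c ∈ Ico 1 l, (2 : ℝ) ^ (c + 1) / D := by
        refine sum_le_sum fun c hc => ?_
        rw [mem_Ico] at hc
        rw [levelWeight, if_neg (by omega), mul_pow, le_div_iff₀ hD0]
        have hpow : (D : ℝ) ^ (c + 1) ≤ D ^ l := pow_le_pow_right₀ hD1 hc.2
        have hDl : (0 : ℝ) < D ^ l := by positivity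
        calc 2 * (2 ^ c * (D : ℝ) ^ c) * (2 * (1 / (2 * D ^ l))) * D
            = 2 ^ (c + 1) * (D ^ (c + 1) / D ^ l) := by field_simp; ring
          _ ≤ 2 ^ (c + 1) * 1 := by gcongr; exact (div_le_one hDl).2 hpow
          _ = 2 ^ (c + 1) := mul_one _
    _ ≤ ∑ c ∈ range l, (2 : ℝ) ^ (c + 1) / D :=
        sum_le_sum_of_subset_of_nonneg (fun c hc => mem_range.2 (mem_Ico.1 hc).2)
          fun _ _ _ => by positivity
    _ ≤ 2 ^ (L + 1) / D := by
        rw [← sum_div]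
        gcongr
        exact (hgeom l).trans (pow_le_pow_right₀ one_le_two (by omega))
    _ = 1 := by rw [hD]; push_cast; exact div_self (by positivity)

lemma sum_capacity_mul_levelCost_le {D L l k : ℕ} (hD : D = 2 ^ (L + 1)) (hl : l ≤ L) :
    ∑ c ∈ Icc 1 L, (capacity D l c k : ℝ) * levelCost D l c ≤ levelWeight D k := by
  have hDpos : 0 < D := by rw [hD]; positivity
  have hD0 : (0 : ℝ) < D := by exact_mod_cast hDpos
  have hw := levelWeight_pos hDpos k
  rcases Nat.eq_zero_or_pos k with rfl | hk
  · have hbound : ∀ c ∈ Icc 1 L, (capacity D l c 0 : ℝ) * levelCost D l c ≤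
        (if c < l then (2 * (2 * (D : ℝ)) ^ c) * (2 * levelWeight D l) else 0) +
          if c = l then 1 else 0 := by
      intro c hc
      rw [mem_Icc] at hc
      rcases lt_trichotomy c l with h | rfl | h
      · simp [capacity, levelCost, h, h.ne]
      · have hc0 : c ≠ 0 := by omega
        simp only [capacity, levelCost, levelWeight, lt_irrefl, if_true, if_false, hc0]
        push_cast
        rw [zero_add, mul_one_div_cancel (by positivity)]
      · have h1 : ¬ c < l := by omega
        have h2 : c ≠ l := by omega
        have h3 : 0 ≠ c := by omega
        simp [capacity, h1, h2, h3]
    refine (sum_le_sum hbound).trans ?_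
    rw [sum_add_distrib, ← sum_filter, sum_ite_eq']
    have hIco : (Icc 1 L).filter (· < l) = Ico 1 l := by
      ext c; simp only [mem_filter, mem_Icc, mem_Ico]; omega
    rw [hIco]
    have := sum_lower_classes_le hD hl
    have hite : (if l ∈ Icc 1 L then (1 : ℝ) else 0) ≤ 1 := by split_ifs <;> norm_num
    simp only [levelWeight, if_true] at this ⊢
    linarith
  · have hbound : ∀ c ∈ Icc 1 L, (capacity D l c k : ℝ) * levelCost D l c ≤
        if c = max l k then levelWeight D k else 0 := by
      intro c hc
      have hk0 : k ≠ 0 := hk.ne'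
      rcases lt_trichotomy c l with h | rfl | h
      · have : c ≠ max l k := by omega
        simp [capacity, h, hk0, this]
      · by_cases hkc : k ≤ c
        · have hmax : c = max c k := by omega
          rw [if_pos hmax]
          have hc0 : c ≠ 0 := by omega
          simp only [capacity, levelCost, levelWeight, lt_irrefl, if_true, if_false, hc0, hk0, hkc]
          push_cast
          have : (D : ℝ) ^ c = D ^ (c - k) * D ^ k := by rw [← pow_add, Nat.sub_add_cancel hkc]
          rw [this]
          refine le_of_eq ?_
          field_simp
        · have hmax : c ≠ max c k := by omega
          simp [capacity, hk0, hkc, hmax]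
      · have h1 : ¬ c < l := by omega
        have h2 : c ≠ l := by omega
        by_cases hkc : k = c
        · subst hkc
          have hmax : k = max l k := by omega
          rw [if_pos hmax]
          simp only [capacity, levelCost, h1, h2, if_true, if_false]
          push_cast
          linarith
        · simp only [capacity, h1, h2, hkc, if_false, Nat.cast_zero, zero_mul]
          split_ifs <;> simp [hw.le]
    refine (sum_le_sum hbound).trans ?_
    rw [sum_ite_eq']
    split_ifs <;> simp [hw.le]

lemma price_le {D l c : ℕ} (hD : 0 < D) (hlc : l ≤ c) (hc : 1 ≤ c) :
    price D c ≤ levelCost D l c / 2 ^ (l + 1) := by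
  have hw := levelWeight_pos hD c
  rcases hlc.eq_or_lt with rfl | h
  · simp only [price, levelCost, lt_irrefl, if_true, if_false]
    rw [pow_succ, mul_comm, div_div]
  · have h1 : ¬ c < l := by omega
    have h2 : c ≠ l := by omega
    simp only [price, levelCost, h1, h2, if_false]
    gcongr
    · norm_num
    · omega

lemma sum_price {D L : ℕ} (hD : 0 < D) :
    ∑ c ∈ Icc 1 L, ((2 * (2 * D) ^ c : ℕ) : ℝ) * price D c = L / 2 := by
  have hD0 : (0 : ℝ) < D := by exact_mod_cast hD
  have : ∀ c ∈ Icc 1 L, ((2 * (2 * D) ^ c : ℕ) : ℝ) * price D c = 1 / 2 := by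
    intro c hc
    have hc0 : c ≠ 0 := by rw [mem_Icc] at hc; omega
    simp only [price, levelWeight, hc0, if_false]
    push_cast
    rw [mul_pow]
    field_simp
  rw [sum_congr rfl this]
  simp
  ring

lemma sum_levelWeight_div {D L : ℕ} (hD : 0 < D) :
    ∑ l ∈ range (L + 1), (((2 * D) ^ l : ℕ) : ℝ) * (levelWeight D l / 2 ^ (l + 1)) =
      1 + L / 4 := by
  have hD0 : (0 : ℝ) < D := by exact_mod_cast hD
  have : ∀ l ∈ range L, (((2 * D) ^ (l + 1) : ℕ) : ℝ) *
      (levelWeight D (l + 1) / 2 ^ (l + 1 + 1)) = 1 / 4 := by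
    intro l _
    simp only [levelWeight, l.succ_ne_zero, if_false]
    push_cast
    rw [mul_pow, pow_succ 2 (l + 1)]
    field_simp
    norm_num
  rw [sum_range_succ', sum_congr rfl this]
  simp [levelWeight]
  ring

/-- For every `ε` with `0 < ε < 1` there is a chore instance with positive weighted maximin shares in which
every allocation gives some agent a cost of at least `2 - ε` times its share. -/
theorem exists_instance_with_pos_shares (ε : ℝ) (hε₀ : 0 < ε) (hε₁ : ε < 1) :
    ∃ (n m : ℕ) (w : Fin n → ℝ) (v : Fin n → Fin m → ℝ),
      ChoreInstance w v ∧ 0 < n ∧ (∀ i, 0 < WMMS w (v i) i) ∧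
      ∀ f : Fin m → Fin n, ∃ i : Fin n,
        (2 - ε) * WMMS w (v i) i ≤ cost (v i) f i := by
  obtain ⟨L, hL⟩ := exists_nat_ge (8 / ε)
  rw [div_le_iff₀ hε₀] at hL
  have hL1 : 1 ≤ L := by
    rcases Nat.eq_zero_or_pos L with rfl | h
    · norm_num at hL
    · exact h
  obtain ⟨D, hD⟩ : ∃ D, D = 2 ^ (L + 1) := ⟨_, rfl⟩
  have hDpos : 0 < D := by rw [hD]; positivity
  obtain ⟨n, lev, hlev, hcard⟩ := exists_labelling (range (L + 1)) fun l => (2 * D) ^ l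
  obtain ⟨m, cls, hcls, hccard⟩ := exists_labelling (Icc 1 L) fun c => 2 * (2 * D) ^ c
  have hn : Nonempty (Fin n) := by
    have h0 := hcard 0 (by simp)
    obtain ⟨i, -⟩ := card_pos.1 (h0 ▸ (by simp : 0 < (2 * D) ^ 0))
    exact ⟨i⟩
  have hm : Nonempty (Fin m) := by
    have h1 := hccard 1 (by simp [hL1])
    obtain ⟨i, -⟩ := card_pos.1 (h1 ▸ (by positivity : 0 < 2 * (2 * D) ^ 1))
    exact ⟨i⟩
  have hw : ∀ i, 0 < levelWeight D (lev i) := fun i => levelWeight_pos hDpos _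
  have hv : ∀ i e, 0 < levelCost D (lev i) (cls e) := fun i e => levelCost_pos hDpos _ _
  refine ⟨n, m, fun i => levelWeight D (lev i), fun i e => levelCost D (lev i) (cls e),
    ⟨hw, fun i e => (hv i e).le⟩, Fin.pos_iff_nonempty.2 hn, fun i => WMMS_pos hw (hv i) i,
    fun f => ?_⟩
  have hshare : ∀ i, WMMS (fun i => levelWeight D (lev i))
      (fun e => levelCost D (lev i) (cls e)) i ≤ levelWeight D (lev i) := by
    intro i
    have hassign : ∀ c, ∃ F : Fin m → Fin n, c ∈ Icc 1 L → ∀ j,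
        ((univ.filter fun e => cls e = c).filter fun e => F e = j).card ≤
          capacity D (lev i) c (lev j) := by
      intro c
      by_cases hc : c ∈ Icc 1 L
      · obtain ⟨F, hF⟩ := exists_assignment (univ.filter fun e => cls e = c)
          (fun j => capacity D (lev i) c (lev j)) (by
            rw [hccard c hc, sum_labels hlev hcard]
            exact le_sum_capacity hc)
        exact ⟨F, fun _ => hF⟩
      · exact ⟨fun _ => i, fun h => absurd h hc⟩
    choose F hF using hassign
    refine WMMS_le_weight hw (f := fun e => F (cls e) e) (fun j => ?_) i
    refine le_trans ?_ (sum_capacity_mul_levelCost_le (k := lev j) hD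
      (Nat.lt_succ_iff.1 (mem_range.1 (hlev i))))
    rw [cost, ← sum_fiberwise_of_maps_to (t := Icc 1 L) (g := cls) fun e _ => hcls e]
    refine sum_le_sum fun c hc => ?_
    rw [sum_congr rfl fun e he => by rw [(mem_filter.1 he).2], sum_const, nsmul_eq_mul]
    refine mul_le_mul_of_nonneg_right ?_ (levelCost_pos hDpos _ _).le
    refine Nat.cast_le.2 ((card_le_card fun e he => ?_).trans (hF c hc j))
    simp only [mem_filter, mem_univ, true_and] at he ⊢
    exact ⟨he.2, he.2 ▸ he.1⟩
  by_contra! hall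
  have hsmall : ∀ i, cost (fun e => levelCost D (lev i) (cls e)) f i <
      (2 - ε) * levelWeight D (lev i) := fun i =>
    (hall i).trans_le (mul_le_mul_of_nonneg_left (hshare i) (by linarith))
  have hbundle : ∀ i, ∑ e ∈ univ.filter (fun e => f e = i), price D (cls e) <
      (2 - ε) * (levelWeight D (lev i) / 2 ^ (lev i + 1)) := by
    intro i
    have hclass : ∀ e ∈ univ.filter (fun e => f e = i), lev i ≤ cls e := by
      intro e he
      by_contra! hlt
      have h1 : levelCost D (lev i) (cls e) ≤ cost (fun e => levelCost D (lev i) (cls e)) f i :=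
        single_le_sum (f := fun e => levelCost D (lev i) (cls e)) (fun e _ => (hv i e).le) he
      have h2 := hsmall i
      rw [levelCost, if_pos hlt] at h1
      nlinarith [mul_pos hε₀ (hw i)]
    calc ∑ e ∈ univ.filter (fun e => f e = i), price D (cls e)
        ≤ ∑ e ∈ univ.filter (fun e => f e = i),
            levelCost D (lev i) (cls e) / 2 ^ (lev i + 1) :=
          sum_le_sum fun e he => price_le hDpos (hclass e he) (mem_Icc.1 (hcls e)).1
      _ = cost (fun e => levelCost D (lev i) (cls e)) f i / 2 ^ (lev i + 1) := by
          rw [cost, sum_div]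
      _ < (2 - ε) * levelWeight D (lev i) / 2 ^ (lev i + 1) := by
          gcongr
          exact hsmall i
      _ = _ := mul_div_assoc _ _ _
  have htotal : ∑ i, ∑ e ∈ univ.filter (fun e => f e = i), price D (cls e) = (L : ℝ) / 2 := by
    rw [sum_fiberwise, sum_labels hcls hccard (price D), sum_price hDpos]
  have hlt := sum_lt_sum_of_nonempty univ_nonempty fun i _ => hbundle i
  rw [htotal, ← mul_sum, sum_labels hlev hcard fun l => levelWeight D l / 2 ^ (l + 1),
    sum_levelWeight_div hDpos] at hlt
  nlinarith

/-- For every `ε` with `0 < ε < 1` there exists a chore instance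
such that for every allocation `(A_1,…,A_n)` some agent `i` has
`v_i(A_i) ≥ (2−ε)·WMMS_i`; hence no algorithm guarantees better than
2-approximate WMMS allocations for chores. -/
theorem lower_bound_two (ε : ℝ) (hε₀ : 0 < ε) (hε₁ : ε < 1) :
    ∃ (n m : ℕ) (w : Fin n → ℝ) (v : Fin n → Fin m → ℝ),
      ChoreInstance w v ∧
      ∀ f : Fin m → Fin n, ∃ i : Fin n,
        (2 - ε) * WMMS w (v i) i ≤ cost (v i) f i := by
  obtain ⟨n, m, w, v, hinst, -, -, h⟩ := exists_instance_with_pos_shares ε hε₀ hε₁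
  exact ⟨n, m, w, v, hinst, h⟩

end Chores
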